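/- Let $d\ge 1$ and $\alpha\in(0,\min(2,d))$. There exists a constant $C>0$, depending only on $d$ and $\alpha$, such that for all $x,x'\in Q$: $\int_0^{\infty} \|G_d(t,x,\cdot)-G_d(t,x',\cdot)\|_{(\alpha)}^2\, dt \le C\, |x-x'|^{2-\alpha}$. -/

import Mathlib

open MeasureTheory

/-- `φ_j(ξ) = √2 sin(jπξ)`. -/
noncomputable def phiF (j : ℕ) (ξ : ℝ) : ℝ := Real.sqrt 2 * Real.sin ((j : ℝ) * Real.pi * ξ)

/-- Green function of the heat operator on `[0,1]` with homogeneous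
Dirichlet boundary conditions: `G(t,x,y) = ∑_{j≥1} e^{-j²π²t} φ_j(x) φ_j(y)`. -/
noncomputable def G (t x y : ℝ) : ℝ :=
  ∑' j : ℕ, Real.exp (-((j : ℝ) + 1) ^ 2 * Real.pi ^ 2 * t) * phiF (j + 1) x * phiF (j + 1) y

/-- The cube `Q = [0,1]^d`. -/
def Q (d : ℕ) : Set (EuclideanSpace ℝ (Fin d)) := {x | ∀ i, x i ∈ Set.Icc (0 : ℝ) 1}

/-- `G_d(t,x,y) = ∏_i G(t,x_i,y_i)` on `Q = [0,1]^d`. -/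
noncomputable def Gd (d : ℕ) (t : ℝ) (x y : EuclideanSpace ℝ (Fin d)) : ℝ :=
  ∏ i, G t (x i) (y i)

/-- `‖φ‖_{(α)}² = ∫_Q ∫_Q |φ(y)| |y-z|^{-α} |φ(z)| dy dz`. -/
noncomputable def normAlphaSq (d : ℕ) (α : ℝ) (f : EuclideanSpace ℝ (Fin d) → ℝ) : ℝ :=
  ∫ y in Q d, ∫ z in Q d, |f y| * ‖y - z‖ ^ (-α) * |f z|


/-! ### Sums of Gaussians -/

lemma gsum_bound {s : ℝ} (hs : 0 < s) :
    Summable (fun j : ℕ => Real.exp (-s * ((j : ℝ) + 1) ^ 2)) ∧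
    ∑' j : ℕ, Real.exp (-s * ((j : ℝ) + 1) ^ 2) ≤ Real.sqrt (Real.pi / s) := by
  have key : ∀ n : ℕ, ∑ j ∈ Finset.range n, Real.exp (-s * ((j : ℝ) + 1) ^ 2)
      ≤ Real.sqrt (Real.pi / s) := by
    intro n
    have h := AntitoneOn.sum_le_integral (f := fun x : ℝ => Real.exp (-s * x ^ 2)) (x₀ := 0) (a := n)
      (by
        intro a ha b hb hab
        simp only [Set.mem_Icc] at ha hb
        apply Real.exp_le_exp.mpr
        have : a ^ 2 ≤ b ^ 2 := by gcongr; exact ha.1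
        nlinarith)
    have h2 : ∫ x in (0:ℝ)..(0 + (n:ℝ)), Real.exp (-s * x ^ 2) ≤ Real.sqrt (Real.pi / s) := by
      rw [← integral_gaussian s, intervalIntegral.integral_of_le (by positivity)]
      exact MeasureTheory.setIntegral_le_integral (integrable_exp_neg_mul_sq hs)
        (Filter.Eventually.of_forall fun x => (Real.exp_pos _).le)
    refine le_trans (le_of_eq ?_) (h.trans h2)
    apply Finset.sum_congr rfl
    intro i _
    push_cast
    ring_nf
  have hsum := summable_of_sum_range_le (fun j => (Real.exp_pos (-s * ((j : ℝ) + 1) ^ 2)).le) key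
  exact ⟨hsum, Real.tsum_le_of_sum_range_le (fun j => (Real.exp_pos _).le) key⟩

lemma mul_exp_le {s u : ℝ} (hs : 0 < s) (hu : 0 ≤ u) :
    u * Real.exp (-s * u ^ 2) ≤ (1 / Real.sqrt s) * Real.exp (-(s / 2) * u ^ 2) := by
  have hsq : 0 < Real.sqrt s := Real.sqrt_pos.mpr hs
  have h1 : Real.exp (-s * u ^ 2) = Real.exp (-(s / 2) * u ^ 2) * Real.exp (-(s / 2) * u ^ 2) := by
    rw [← Real.exp_add]; ring_nf
  have h2 : u * Real.exp (-(s / 2) * u ^ 2) ≤ 1 / Real.sqrt s := by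
    rw [le_div_iff₀ hsq]
    have h3 : Real.exp (-(s / 2) * u ^ 2) = (Real.exp (s / 2 * u ^ 2))⁻¹ := by
      rw [← Real.exp_neg]; ring_nf
    have h4 : u * Real.sqrt s ≤ Real.exp (s / 2 * u ^ 2) := by
      have := Real.add_one_le_exp (s / 2 * u ^ 2)
      have h5 : (Real.sqrt s) ^ 2 = s := Real.sq_sqrt hs.le
      have h6 : s / 2 * u ^ 2 = (u * Real.sqrt s) ^ 2 / 2 := by rw [mul_pow, h5]; ring
      nlinarith [sq_nonneg (u * Real.sqrt s - 1)]
    rw [h3]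
    calc u * (Real.exp (s / 2 * u ^ 2))⁻¹ * Real.sqrt s
        = u * Real.sqrt s / Real.exp (s / 2 * u ^ 2) := by ring
      _ ≤ 1 := by rw [div_le_one (Real.exp_pos _)]; exact h4
  rw [h1, ← mul_assoc]
  gcongr

lemma gsum_bound1 {s : ℝ} (hs : 0 < s) :
    Summable (fun j : ℕ => ((j : ℝ) + 1) * Real.exp (-s * ((j : ℝ) + 1) ^ 2)) ∧
    ∑' j : ℕ, ((j : ℝ) + 1) * Real.exp (-s * ((j : ℝ) + 1) ^ 2)
      ≤ Real.sqrt (2 * Real.pi) / s := by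
  obtain ⟨hS, hB⟩ := gsum_bound (s := s / 2) (by positivity)
  have hle : ∀ j : ℕ, ((j : ℝ) + 1) * Real.exp (-s * ((j : ℝ) + 1) ^ 2)
      ≤ (1 / Real.sqrt s) * Real.exp (-(s / 2) * ((j : ℝ) + 1) ^ 2) :=
    fun j => mul_exp_le hs (by positivity)
  have hS2 := hS.mul_left (1 / Real.sqrt s)
  have hS3 := Summable.of_nonneg_of_le (fun j : ℕ => by positivity) hle hS2
  refine ⟨hS3, (hS3.tsum_le_tsum hle hS2).trans ?_⟩
  rw [tsum_mul_left]
  calc 1 / Real.sqrt s * _ ≤ 1 / Real.sqrt s * Real.sqrt (Real.pi / (s / 2)) := by gcongr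
    _ = Real.sqrt (2 * Real.pi) / s := by
      rw [show Real.pi / (s / 2) = 2 * Real.pi / s by field_simp, Real.sqrt_div (by positivity)]
      have : Real.sqrt s * Real.sqrt s = s := Real.mul_self_sqrt hs.le
      have hsq : 0 < Real.sqrt s := Real.sqrt_pos.mpr hs
      rw [div_mul_div_comm, this, one_mul]

/-! ### Sup bounds on `G` -/

lemma phi_mul (j : ℕ) (x y : ℝ) : phiF j x * phiF j y
    = 2 * (Real.sin (j * Real.pi * x) * Real.sin (j * Real.pi * y)) := by
  unfold phiF
  have : Real.sqrt 2 * Real.sqrt 2 = 2 := Real.mul_self_sqrt (by norm_num)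
  linear_combination (Real.sin (j * Real.pi * x) * Real.sin (j * Real.pi * y)) * this

lemma G_term (t x y : ℝ) (j : ℕ) :
    Real.exp (-((j : ℝ) + 1) ^ 2 * Real.pi ^ 2 * t) * phiF (j + 1) x * phiF (j + 1) y
    = 2 * (Real.sin (((j:ℝ) + 1) * Real.pi * x) * Real.sin (((j:ℝ) + 1) * Real.pi * y)) *
      Real.exp (-(Real.pi ^ 2 * t) * ((j : ℝ) + 1) ^ 2) := by
  rw [mul_assoc, phi_mul]
  push_cast
  rw [mul_comm]
  ring_nf

lemma G_eq (t x y : ℝ) : G t x y = ∑' j : ℕ,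
    2 * (Real.sin (((j:ℝ) + 1) * Real.pi * x) * Real.sin (((j:ℝ) + 1) * Real.pi * y)) *
      Real.exp (-(Real.pi ^ 2 * t) * ((j : ℝ) + 1) ^ 2) := by
  unfold G
  exact tsum_congr (G_term t x y)

lemma G_term_le (t x y : ℝ) (j : ℕ) :
    ‖2 * (Real.sin (((j:ℝ) + 1) * Real.pi * x) * Real.sin (((j:ℝ) + 1) * Real.pi * y)) *
      Real.exp (-(Real.pi ^ 2 * t) * ((j : ℝ) + 1) ^ 2)‖
    ≤ 2 * Real.exp (-(Real.pi ^ 2 * t) * ((j : ℝ) + 1) ^ 2) := by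
  rw [norm_mul, norm_mul, norm_mul]
  simp only [Real.norm_eq_abs, Real.abs_exp]
  have h1 := Real.abs_sin_le_one (((j:ℝ) + 1) * Real.pi * x)
  have h2 := Real.abs_sin_le_one (((j:ℝ) + 1) * Real.pi * y)
  have h3 : |Real.sin (((j:ℝ) + 1) * Real.pi * x)| * |Real.sin (((j:ℝ) + 1) * Real.pi * y)| ≤ 1 :=
    mul_le_one₀ h1 (abs_nonneg _) h2
  have : |(2:ℝ)| = 2 := by norm_num
  rw [this]
  have h4 := Real.exp_pos (-(Real.pi ^ 2 * t) * ((j : ℝ) + 1) ^ 2)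
  nlinarith

lemma G_summable {t : ℝ} (ht : 0 < t) (x y : ℝ) : Summable (fun j : ℕ =>
    2 * (Real.sin (((j:ℝ) + 1) * Real.pi * x) * Real.sin (((j:ℝ) + 1) * Real.pi * y)) *
      Real.exp (-(Real.pi ^ 2 * t) * ((j : ℝ) + 1) ^ 2)) :=
  Summable.of_norm_bounded ((gsum_bound (s := Real.pi ^ 2 * t) (by positivity)).1.mul_left 2)
    (G_term_le t x y)

lemma G_continuous {t : ℝ} (ht : 0 < t) (x : ℝ) : Continuous (G t x) := by
  have : G t x = fun y => ∑' j : ℕ,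
    2 * (Real.sin (((j:ℝ) + 1) * Real.pi * x) * Real.sin (((j:ℝ) + 1) * Real.pi * y)) *
      Real.exp (-(Real.pi ^ 2 * t) * ((j : ℝ) + 1) ^ 2) := funext fun y => G_eq t x y
  rw [this]
  exact continuous_tsum (fun j => by fun_prop)
    ((gsum_bound (s := Real.pi ^ 2 * t) (by positivity)).1.mul_left 2)
    (fun j y => G_term_le t x y j)

lemma G_sup {t : ℝ} (ht : 0 < t) (x y : ℝ) : |G t x y| ≤ 10 / Real.sqrt t := by
  obtain ⟨hS, hB⟩ := gsum_bound (s := Real.pi ^ 2 * t) (by positivity)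
  rw [G_eq, ← Real.norm_eq_abs]
  refine (tsum_of_norm_bounded (hS.mul_left 2).hasSum (G_term_le t x y)).trans ?_
  rw [tsum_mul_left]
  have : Real.pi / (Real.pi ^ 2 * t) ≤ 1 / t := by
    rw [div_le_div_iff₀ (by positivity) ht]
    have := Real.pi_gt_three
    nlinarith [mul_pos Real.pi_pos ht]
  calc 2 * _ ≤ 2 * Real.sqrt (Real.pi / (Real.pi ^ 2 * t)) := by gcongr
    _ ≤ 2 * Real.sqrt (1 / t) := by gcongr
    _ = 2 / Real.sqrt t := by rw [Real.sqrt_div (by norm_num)]; simp; ring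
    _ ≤ 10 / Real.sqrt t := by gcongr; norm_num

lemma G_sup_diff {t : ℝ} (ht : 0 < t) (x x' y : ℝ) :
    |G t x y - G t x' y| ≤ 10 * |x - x'| / t := by
  obtain ⟨hS, hB⟩ := gsum_bound1 (s := Real.pi ^ 2 * t) (by positivity)
  rw [G_eq, G_eq, ← (G_summable ht x y).tsum_sub (G_summable ht x' y), ← Real.norm_eq_abs]
  refine (tsum_of_norm_bounded (hS.mul_left (2 * Real.pi * |x - x'|)).hasSum ?_).trans ?_
  · intro j
    have h1 : |Real.sin (((j:ℝ) + 1) * Real.pi * x) - Real.sin (((j:ℝ) + 1) * Real.pi * x')|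
        ≤ ((j:ℝ) + 1) * Real.pi * |x - x'| := by
      refine (Real.abs_sin_sub_sin_le _ _).trans (le_of_eq ?_)
      rw [← mul_sub, abs_mul, abs_of_nonneg (by positivity)]
    have h2 := Real.abs_sin_le_one (((j:ℝ) + 1) * Real.pi * y)
    have h3 := Real.exp_pos (-(Real.pi ^ 2 * t) * ((j : ℝ) + 1) ^ 2)
    rw [Real.norm_eq_abs, ← sub_mul, ← mul_sub, ← sub_mul, abs_mul, abs_mul, abs_mul, Real.abs_exp,
      abs_two]
    calc _ ≤ 2 * (((j:ℝ) + 1) * Real.pi * |x - x'| * 1) *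
        Real.exp (-(Real.pi ^ 2 * t) * ((j : ℝ) + 1) ^ 2) := by gcongr
      _ = _ := by ring
  · rw [tsum_mul_left]
    have hpi := Real.pi_gt_three
    have hpi4 := Real.pi_le_four
    have h3 : Real.sqrt (2 * Real.pi) ≤ 3 := by
      rw [Real.sqrt_le_left (by norm_num)]; linarith
    calc _ ≤ (2 * Real.pi * |x - x'|) * (3 / (Real.pi ^ 2 * t)) := by
            gcongr; exact hB.trans (by gcongr)
      _ = (6 / Real.pi) * |x - x'| / t := by field_simp; ring
      _ ≤ _ := by
        gcongr
        rw [div_le_iff₀ Real.pi_pos]; linarith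

/-! ### Poisson summation -/

/-- The Gaussian heat kernel on the line. -/
noncomputable def pk (t v : ℝ) : ℝ :=
  (1 / (2 * Real.sqrt (Real.pi * t))) * Real.exp (-(1 / (4 * t)) * v ^ 2)

lemma hasSum_of_eq {ι : Type} {f g : ι → ℝ} {a b : ℝ} (h : HasSum f a) (hf : ∀ n, g n = f n)
    (hb : b = a) : HasSum g b := by
  rw [hb, funext hf]; exact h

lemma cosK_hasSum {t : ℝ} (ht : 0 < t) (u : ℝ) :
    HasSum (fun n : ℤ => 2 * pk t (2 * n + u)) (HurwitzZeta.cosKernel ((u / 2 : ℝ) : UnitAddCircle) (Real.pi * t)) := by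
  have hpt : 0 < Real.pi * t := by positivity
  have h1 := HurwitzZeta.hasSum_int_evenKernel (u / 2) (t := 1 / (Real.pi * t)) (by positivity)
  have h2 := HurwitzZeta.evenKernel_functional_equation ((u / 2 : ℝ) : UnitAddCircle) (1 / (Real.pi * t))
  rw [h2, one_div_one_div, ← Real.sqrt_eq_rpow, Real.sqrt_div (by norm_num), Real.sqrt_one,
    one_div_one_div] at h1
  have hs : 0 < Real.sqrt (Real.pi * t) := Real.sqrt_pos.mpr hpt
  have h3 := h1.mul_left (1 / Real.sqrt (Real.pi * t))
  rw [← mul_assoc, one_div_mul_cancel hs.ne', one_mul] at h3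
  refine hasSum_of_eq h3 (fun n => ?_) rfl
  unfold pk
  rw [← mul_assoc]
  congr 1
  · field_simp
  · congr 1
    field_simp
    ring

lemma G_poisson {t : ℝ} (ht : 0 < t) (x y : ℝ) :
    HasSum (fun n : ℤ => pk t (2 * n + (x - y)) - pk t (2 * n + (x + y))) (G t x y) := by
  have hpt : 0 < Real.pi * t := by positivity
  have h1 := (HurwitzZeta.hasSum_nat_cosKernel₀ ((x - y) / 2) hpt).sub
    (HurwitzZeta.hasSum_nat_cosKernel₀ ((x + y) / 2) hpt)
  have h2 := (G_summable ht x y).hasSum.mul_left 2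
  rw [← G_eq] at h2
  have h3 : HasSum (fun j : ℕ => (2:ℝ) * (2 * (Real.sin (((j:ℝ) + 1) * Real.pi * x) * Real.sin (((j:ℝ) + 1) * Real.pi * y)) *
      Real.exp (-(Real.pi ^ 2 * t) * ((j : ℝ) + 1) ^ 2)))
      (HurwitzZeta.cosKernel (((x - y) / 2 : ℝ) : UnitAddCircle) (Real.pi * t) - 1 -
      (HurwitzZeta.cosKernel (((x + y) / 2 : ℝ) : UnitAddCircle) (Real.pi * t) - 1)) := by
    refine hasSum_of_eq h1 (fun j => ?_) rfl
    rw [← sub_mul, ← mul_sub, ← mul_assoc]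
    congr 1
    · have e1 : 2 * Real.pi * ((x - y) / 2) * ((j:ℝ) + 1)
        = ((j:ℝ) + 1) * Real.pi * x - ((j:ℝ) + 1) * Real.pi * y := by ring
      have e2 : 2 * Real.pi * ((x + y) / 2) * ((j:ℝ) + 1)
        = ((j:ℝ) + 1) * Real.pi * x + ((j:ℝ) + 1) * Real.pi * y := by ring
      rw [e1, e2, Real.cos_sub, Real.cos_add]
      ring
    · congr 1; ring
  have h4 := h2.unique h3
  have h5 := ((cosK_hasSum ht (x - y)).sub (cosK_hasSum ht (x + y))).mul_left (1 / 2)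
  refine hasSum_of_eq h5 (fun n => ?_) ?_
  · ring
  · linarith

lemma pk_continuous (t : ℝ) : Continuous (pk t) := by unfold pk; fun_prop

/-! ### Tiling -/

lemma tile (g : ℝ → ENNReal) :
    ∑' n : ℤ, ∫⁻ y in Set.Icc (0:ℝ) 1, g (2 * n + y) ≤ ∫⁻ v, g v := by
  have h : ∀ n : ℤ, ∫⁻ y in Set.Icc (0:ℝ) 1, g (2 * n + y)
      = ∫⁻ v in Set.Icc (2 * n : ℝ) (2 * n + 1), g v := by
    intro n
    rw [← lintegral_indicator measurableSet_Icc, ← lintegral_indicator measurableSet_Icc,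
      ← lintegral_add_left_eq_self (Set.indicator (Set.Icc (2 * n : ℝ) (2 * n + 1)) g) (2 * n : ℝ)]
    congr 1
    ext y
    simp only [Set.indicator, Set.mem_Icc]
    congr 1
    apply propext
    constructor <;> rintro ⟨h1, h2⟩ <;> constructor <;> linarith
  simp_rw [h]
  rw [← lintegral_iUnion (fun n => measurableSet_Icc)]
  · exact setLIntegral_le_lintegral _ _
  · intro m n hmn
    rw [Function.onFun, Set.disjoint_left]
    rintro v ⟨h1, h2⟩ ⟨h3, h4⟩
    apply hmn
    have a1 : (m : ℝ) < n + 1 := by linarith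
    have a2 : (n : ℝ) < m + 1 := by linarith
    norm_cast at a1 a2
    omega

lemma tile_neg (g : ℝ → ENNReal) :
    ∑' n : ℤ, ∫⁻ y in Set.Icc (0:ℝ) 1, g (2 * n - y) ≤ ∫⁻ v, g v := by
  have := tile (fun v => g (-v))
  rw [lintegral_neg_eq_self g, ← (Equiv.neg ℤ).tsum_eq] at this
  refine le_trans (le_of_eq ?_) this
  congr 1; ext n
  congr 1; ext y
  congr 1
  simp; ring

lemma fold_bound {q : ℝ → ℝ} (hq : Continuous q) {F : ℝ → ℝ}
    (hF : ∀ y, HasSum (fun n : ℤ => q (2 * n - y) - q (2 * n + y)) (F y)) :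
    ∫⁻ y in Set.Icc (0:ℝ) 1, ‖F y‖ₑ ≤ 2 * ∫⁻ v, ‖q v‖ₑ := by
  have hm : Measurable q := hq.measurable
  calc ∫⁻ y in Set.Icc (0:ℝ) 1, ‖F y‖ₑ
      ≤ ∫⁻ y in Set.Icc (0:ℝ) 1, ∑' n : ℤ, (‖q (2 * n - y)‖ₑ + ‖q (2 * n + y)‖ₑ) := by
        apply lintegral_mono
        intro y
        dsimp only
        rw [← (hF y).tsum_eq]
        exact enorm_tsum_le_tsum_enorm.trans (ENNReal.tsum_le_tsum fun n => enorm_sub_le)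
    _ = ∑' n : ℤ, ((∫⁻ y in Set.Icc (0:ℝ) 1, ‖q (2 * n - y)‖ₑ)
          + ∫⁻ y in Set.Icc (0:ℝ) 1, ‖q (2 * n + y)‖ₑ) := by
        rw [lintegral_tsum (fun n => by fun_prop)]
        congr 1; ext n
        rw [lintegral_add_left (by fun_prop)]
    _ ≤ (∫⁻ v, ‖q v‖ₑ) + ∫⁻ v, ‖q v‖ₑ := by
        rw [ENNReal.tsum_add]
        exact add_le_add (tile_neg fun v => ‖q v‖ₑ) (tile fun v => ‖q v‖ₑ)
    _ = _ := by rw [two_mul]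

lemma gauss_lint {b : ℝ} (hb : 0 < b) :
    ∫⁻ v : ℝ, ENNReal.ofReal (Real.exp (-b * v ^ 2)) = ENNReal.ofReal (Real.sqrt (Real.pi / b)) := by
  rw [← integral_gaussian, ofReal_integral_eq_lintegral_ofReal (integrable_exp_neg_mul_sq hb)
    (Filter.Eventually.of_forall fun x => (Real.exp_pos _).le)]

lemma pk_L1 {t : ℝ} (ht : 0 < t) : ∫⁻ v, ‖pk t v‖ₑ ≤ ENNReal.ofReal 1 := by
  have : ∀ v, ‖pk t v‖ₑ = ENNReal.ofReal (1 / (2 * Real.sqrt (Real.pi * t))) *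
      ENNReal.ofReal (Real.exp (-(1 / (4 * t)) * v ^ 2)) := by
    intro v
    rw [← ENNReal.ofReal_mul (by positivity), ← Real.enorm_of_nonneg (by positivity)]
    rfl
  simp_rw [this]
  rw [lintegral_const_mul _ (by fun_prop), gauss_lint (by positivity),
    ← ENNReal.ofReal_mul (by positivity)]
  apply ENNReal.ofReal_le_ofReal
  rw [show Real.pi / (1 / (4 * t)) = 2 ^ 2 * (Real.pi * t) by field_simp; ring,
    Real.sqrt_mul (by norm_num) (Real.pi * t), Real.sqrt_sq (by norm_num)]
  have hs : 0 < Real.sqrt (Real.pi * t) := Real.sqrt_pos.mpr (by positivity)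
  apply le_of_eq
  field_simp

/-- Derivative of `pk`. -/
noncomputable def pk' (t v : ℝ) : ℝ :=
  (1 / (2 * Real.sqrt (Real.pi * t))) * (Real.exp (-(1 / (4 * t)) * v ^ 2) * (-(1 / (4 * t)) * (2 * v)))

lemma pk_deriv (t v : ℝ) : HasDerivAt (pk t) (pk' t v) v := by
  unfold pk pk'
  have h : HasDerivAt (fun v : ℝ => -(1 / (4 * t)) * v ^ 2) (-(1 / (4 * t)) * (2 * v)) v := by
    have := (hasDerivAt_pow 2 v).const_mul (-(1 / (4 * t)))
    simpa using this
  exact h.exp.const_mul _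

lemma pk'_continuous (t : ℝ) : Continuous (pk' t) := by unfold pk'; fun_prop

lemma pk'_L1 {t : ℝ} (ht : 0 < t) : ∫⁻ v, ‖pk' t v‖ₑ ≤ ENNReal.ofReal (2 / Real.sqrt t) := by
  have hs : 0 < Real.sqrt (Real.pi * t) := Real.sqrt_pos.mpr (by positivity)
  have hst : 0 < Real.sqrt t := Real.sqrt_pos.mpr ht
  have hq : Real.sqrt (1 / (4 * t)) = 1 / (2 * Real.sqrt t) := by
    rw [show (1 / (4 * t)) = (1 / (2 * Real.sqrt t)) ^ 2 by
      rw [div_pow, mul_pow, Real.sq_sqrt ht.le]; norm_num, Real.sqrt_sq (by positivity)]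
  have : ∀ v, ‖pk' t v‖ₑ ≤ ENNReal.ofReal (1 / (2 * Real.sqrt (Real.pi * t)) * (1 / (4 * t) * 2) *
      (2 * Real.sqrt t)) * ENNReal.ofReal (Real.exp (-((1 / (4 * t)) / 2) * v ^ 2)) := by
    intro v
    rw [← ENNReal.ofReal_mul (by positivity), Real.enorm_eq_ofReal_abs]
    apply ENNReal.ofReal_le_ofReal
    unfold pk'
    have h := mul_exp_le (s := 1 / (4 * t)) (u := |v|) (by positivity) (abs_nonneg v)
    rw [hq, sq_abs, one_div_one_div] at h
    rw [abs_mul, abs_mul, abs_mul, abs_mul, abs_neg, Real.abs_exp, abs_two,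
      abs_of_pos (by positivity : 0 < 1 / (2 * Real.sqrt (Real.pi * t))),
      abs_of_pos (by positivity : 0 < 1 / (4 * t))]
    calc _ = 1 / (2 * Real.sqrt (Real.pi * t)) * (1 / (4 * t) * 2) * (|v| * Real.exp (-(1 / (4 * t)) * v ^ 2)) := by ring
      _ ≤ _ := by
        rw [mul_assoc (1 / (2 * Real.sqrt (Real.pi * t)) * (1 / (4 * t) * 2))]
        gcongr
  refine (lintegral_mono this).trans ?_
  rw [lintegral_const_mul _ (by fun_prop), gauss_lint (by positivity),
    ← ENNReal.ofReal_mul (by positivity)]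
  apply ENNReal.ofReal_le_ofReal
  rw [show Real.pi / (1 / (4 * t) / 2) = 8 * (Real.pi * t) by field_simp; ring,
    Real.sqrt_mul (by norm_num) (Real.pi * t)]
  have h8 : Real.sqrt 8 ≤ 4 := by rw [Real.sqrt_le_left (by norm_num)]; norm_num
  have htt : Real.sqrt t * Real.sqrt t = t := Real.mul_self_sqrt ht.le
  calc _ = (Real.sqrt 8) * (Real.sqrt t) / (2 * (Real.sqrt t * Real.sqrt t)) := by rw [htt]; field_simp; try ring
    _ = Real.sqrt 8 / 2 / Real.sqrt t := by field_simp
    _ ≤ _ := by gcongr; linarith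

lemma pk_diff_L1 {t : ℝ} (ht : 0 < t) (x x' : ℝ) :
    ∫⁻ v, ‖pk t (v + x) - pk t (v + x')‖ₑ ≤ ENNReal.ofReal (2 * |x - x'| / Real.sqrt t) := by
  have hm : Measurable (pk' t) := (pk'_continuous t).measurable
  have h1 : ∀ v, ‖pk t (v + x) - pk t (v + x')‖ₑ ≤ ∫⁻ s in Set.uIoc x' x, ‖pk' t (v + s)‖ₑ := by
    intro v
    have := intervalIntegral.integral_eq_sub_of_hasDerivAt (a := x') (b := x)
      (f := fun s => pk t (v + s)) (f' := fun s => pk' t (v + s))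
      (fun s _ => HasDerivAt.comp_const_add v s (pk_deriv t (v + s)))
      (((pk'_continuous t).comp (continuous_const.add continuous_id)).intervalIntegrable _ _)
    rw [← this, ← enorm_norm, intervalIntegral.norm_intervalIntegral_eq, enorm_norm]
    exact enorm_integral_le_lintegral_enorm _
  refine (lintegral_mono h1).trans ?_
  rw [lintegral_lintegral_swap (by
    apply Measurable.aemeasurable
    unfold Function.uncurry
    fun_prop)]
  simp_rw [lintegral_add_right_eq_self (fun v => ‖pk' t v‖ₑ)]
  rw [lintegral_const, Measure.restrict_apply_univ, Set.uIoc, Real.volume_Ioc, max_sub_min_eq_abs']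
  refine (mul_le_mul_left (pk'_L1 ht) _).trans ?_
  rw [← ENNReal.ofReal_mul (by positivity), abs_sub_comm]
  apply ENNReal.ofReal_le_ofReal
  apply le_of_eq; ring

lemma G_L1 {t : ℝ} (ht : 0 < t) (x : ℝ) :
    ∫⁻ y in Set.Icc (0:ℝ) 1, ‖G t x y‖ₑ ≤ ENNReal.ofReal 10 := by
  have h := fold_bound (q := fun v => pk t (v + x)) (F := G t x)
    ((pk_continuous t).comp (continuous_id.add continuous_const)) (by
      intro y
      convert G_poisson ht x y using 4 <;> ring)
  rw [lintegral_add_right_eq_self (fun v => ‖pk t v‖ₑ)] at h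
  refine h.trans ((mul_le_mul_right (pk_L1 ht) 2).trans ?_)
  rw [← ENNReal.ofReal_ofNat 2, ← ENNReal.ofReal_mul (by norm_num)]
  apply ENNReal.ofReal_le_ofReal; norm_num

lemma G_L1_diff {t : ℝ} (ht : 0 < t) (x x' : ℝ) :
    ∫⁻ y in Set.Icc (0:ℝ) 1, ‖G t x y - G t x' y‖ₑ ≤ ENNReal.ofReal (10 * |x - x'| / Real.sqrt t) := by
  have h := fold_bound (q := fun v => pk t (v + x) - pk t (v + x')) (F := fun y => G t x y - G t x' y)
    (((pk_continuous t).comp (continuous_id.add continuous_const)).sub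
      ((pk_continuous t).comp (continuous_id.add continuous_const))) (by
      intro y
      refine hasSum_of_eq ((G_poisson ht x y).sub (G_poisson ht x' y)) (fun n => ?_) rfl
      rw [show (2 * (n:ℝ) + (x - y)) = 2 * n - y + x by ring, show (2 * (n:ℝ) + (x + y)) = 2 * n + y + x by ring,
        show (2 * (n:ℝ) + (x' - y)) = 2 * n - y + x' by ring, show (2 * (n:ℝ) + (x' + y)) = 2 * n + y + x' by ring]
      ring)
  refine h.trans ((mul_le_mul_right (pk_diff_L1 ht x x') 2).trans ?_)
  rw [← ENNReal.ofReal_ofNat 2, ← ENNReal.ofReal_mul (by norm_num)]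
  apply ENNReal.ofReal_le_ofReal
  rw [← mul_div_assoc, ← mul_assoc]
  gcongr; norm_num

/-! ### Products -/

lemma lint_pi_prod : ∀ (n : ℕ) (f : Fin n → ℝ → ENNReal), (∀ i, Measurable (f i)) →
    ∫⁻ y : Fin n → ℝ, ∏ i, f i (y i) = ∏ i, ∫⁻ s, f i s := by
  intro n
  induction n with
  | zero =>
    intro f hf
    simp [Measure.volume_pi_eq_dirac (0 : Fin 0 → ℝ)]
  | succ n ih =>
    intro f hf
    have h1 := (volume_preserving_piFinSuccAbove (fun _ : Fin (n + 1) => ℝ) 0)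
    have h2 : ∀ y : Fin (n + 1) → ℝ, ∏ i, f i (y i) =
        (fun z : ℝ × (Fin n → ℝ) => f 0 z.1 * ∏ i : Fin n, f i.succ (z.2 i))
          (MeasurableEquiv.piFinSuccAbove (fun _ : Fin (n + 1) => ℝ) 0 y) := by
      intro y
      rw [Fin.prod_univ_succ]
      rfl
    simp_rw [h2]
    rw [h1.lintegral_comp (f := fun z : ℝ × (Fin n → ℝ) => f 0 z.1 * ∏ i : Fin n, f i.succ (z.2 i))
      (by
        have h0 := hf 0
        have hs : ∀ i : Fin n, Measurable (f i.succ) := fun i => hf _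
        fun_prop)]
    rw [Fin.prod_univ_succ, ← ih (fun i => f i.succ) (fun i => hf _)]
    have hs : ∀ i : Fin n, Measurable (f i.succ) := fun i => hf _
    have hg : Measurable (fun z : Fin n → ℝ => ∏ i : Fin n, f i.succ (z i)) := by fun_prop
    exact lintegral_prod_mul (hf 0).aemeasurable hg.aemeasurable

lemma lint_euc_prod (d : ℕ) (f : Fin d → ℝ → ENNReal) (hf : ∀ i, Measurable (f i)) :
    ∫⁻ y : EuclideanSpace ℝ (Fin d), ∏ i, f i (y i) = ∏ i, ∫⁻ s, f i s := by
  rw [← lint_pi_prod d f hf]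
  exact ((PiLp.volume_preserving_toLp (Fin d)).lintegral_comp
    (f := fun y : EuclideanSpace ℝ (Fin d) => ∏ i, f i (y i)) (by fun_prop)).symm

lemma Q_measurable (d : ℕ) : MeasurableSet (Q d) := by
  have : Q d = ⋂ i : Fin d, (fun x : EuclideanSpace ℝ (Fin d) => x i) ⁻¹' (Set.Icc (0:ℝ) 1) := by
    ext x; simp [Q]
  rw [this]
  exact MeasurableSet.iInter fun i => (by fun_prop : Measurable fun x : EuclideanSpace ℝ (Fin d) => x i)
    measurableSet_Icc

lemma lint_Q_prod (d : ℕ) (f : Fin d → ℝ → ENNReal) (hf : ∀ i, Measurable (f i)) :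
    ∫⁻ y in Q d, ∏ i, f i (y i) = ∏ i, ∫⁻ s in Set.Icc (0:ℝ) 1, f i s := by
  simp_rw [← lintegral_indicator measurableSet_Icc]
  rw [← lint_euc_prod d _ (fun i => (hf i).indicator measurableSet_Icc),
    ← lintegral_indicator (Q_measurable d)]
  congr 1; ext y
  by_cases hy : y ∈ Q d
  · rw [Set.indicator_of_mem hy]
    exact Finset.prod_congr rfl fun i _ => (Set.indicator_of_mem (hy i) _).symm
  · rw [Set.indicator_of_notMem hy]
    have : ∃ i, y i ∉ Set.Icc (0:ℝ) 1 := by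
      by_contra hcon
      push Not at hcon
      exact hy hcon
    obtain ⟨i, hi⟩ := this
    exact (Finset.prod_eq_zero (Finset.mem_univ i) (Set.indicator_of_notMem hi _)).symm

lemma abs_prod_sub_le : ∀ (n : ℕ) (a b : Fin n → ℝ),
    |∏ i, a i - ∏ i, b i| ≤ ∑ i, ∏ k, (if k = i then |a k - b k| else |a k| + |b k|) := by
  intro n
  induction n with
  | zero => intro a b; simp
  | succ n ih =>
    intro a b
    rw [Fin.prod_univ_succ, Fin.prod_univ_succ, Fin.sum_univ_succ]
    simp only [Fin.prod_univ_succ, if_true, Fin.succ_ne_zero, if_false, Fin.succ_inj,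
      (Fin.succ_ne_zero _).symm]
    rw [← Finset.mul_sum]
    have h := ih (fun i => a i.succ) (fun i => b i.succ)
    have h2 : |∏ i : Fin n, a i.succ| ≤ ∏ i : Fin n, (|a i.succ| + |b i.succ|) := by
      rw [Finset.abs_prod]
      exact Finset.prod_le_prod (fun i _ => abs_nonneg _)
        fun i _ => le_add_of_nonneg_right (abs_nonneg _)
    rw [show a 0 * ∏ i : Fin n, a i.succ - b 0 * ∏ i : Fin n, b i.succ
      = (a 0 - b 0) * ∏ i : Fin n, a i.succ +
        b 0 * (∏ i : Fin n, a i.succ - ∏ i : Fin n, b i.succ) by ring]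
    refine (abs_add_le _ _).trans ?_
    rw [abs_mul, abs_mul]
    gcongr
    exact le_add_of_nonneg_left (abs_nonneg _)

lemma prod_ite_bound (d : ℕ) (c m : ℝ) (i : Fin d) :
    ∏ k : Fin d, (c * (if k = i then m else 1)) = c ^ d * m := by
  rw [Finset.prod_mul_distrib, Finset.prod_ite_eq']
  simp

/-! ### One-dimensional bounds with the factor `min 1 (h / √t)` -/

lemma G1_sup {t h : ℝ} (ht : 0 < t) {x x' : ℝ} (hh : |x - x'| ≤ h) (y : ℝ) :
    |G t x y - G t x' y| ≤ 20 * (1 / Real.sqrt t) * min 1 (h / Real.sqrt t) := by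
  have hs : 0 < Real.sqrt t := Real.sqrt_pos.mpr ht
  have hst : Real.sqrt t * Real.sqrt t = t := Real.mul_self_sqrt ht.le
  rw [mul_min_of_nonneg _ _ (by positivity)]
  apply le_min
  · refine (abs_sub _ _).trans ((add_le_add (G_sup ht x y) (G_sup ht x' y)).trans (le_of_eq ?_))
    ring
  · refine (G_sup_diff ht x x' y).trans ?_
    calc 10 * |x - x'| / t ≤ 20 * h / t := by
          gcongr
          norm_num
      _ = 20 * h / (Real.sqrt t * Real.sqrt t) := by rw [hst]
      _ = _ := by field_simp

lemma G1_L1 {t h : ℝ} (ht : 0 < t) {x x' : ℝ} (hh : |x - x'| ≤ h) :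
    ∫⁻ y in Set.Icc (0:ℝ) 1, ENNReal.ofReal |G t x y - G t x' y|
      ≤ ENNReal.ofReal (20 * min 1 (h / Real.sqrt t)) := by
  have hm := (G_continuous ht x).measurable
  have hm' := (G_continuous ht x').measurable
  simp_rw [← Real.enorm_eq_ofReal_abs]
  rw [mul_min_of_nonneg _ _ (by positivity), ENNReal.ofReal_min]
  apply le_min
  · calc ∫⁻ y in Set.Icc (0:ℝ) 1, ‖G t x y - G t x' y‖ₑ
        ≤ ∫⁻ y in Set.Icc (0:ℝ) 1, (‖G t x y‖ₑ + ‖G t x' y‖ₑ) := lintegral_mono fun y => enorm_sub_le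
      _ ≤ ENNReal.ofReal 10 + ENNReal.ofReal 10 := by
        rw [lintegral_add_left (by fun_prop)]
        exact add_le_add (G_L1 ht x) (G_L1 ht x')
      _ = _ := by rw [← ENNReal.ofReal_add (by norm_num) (by norm_num)]; norm_num
  · refine (G_L1_diff ht x x').trans (ENNReal.ofReal_le_ofReal ?_)
    rw [← mul_div_assoc]
    gcongr
    norm_num

lemma G1_L1_sum {t : ℝ} (ht : 0 < t) (x x' : ℝ) :
    ∫⁻ y in Set.Icc (0:ℝ) 1, ENNReal.ofReal (|G t x y| + |G t x' y|) ≤ ENNReal.ofReal 20 := by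
  have hm := (G_continuous ht x).measurable
  have hm' := (G_continuous ht x').measurable
  have : ∀ y, ENNReal.ofReal (|G t x y| + |G t x' y|) = ‖G t x y‖ₑ + ‖G t x' y‖ₑ := by
    intro y
    rw [ENNReal.ofReal_add (abs_nonneg _) (abs_nonneg _), Real.enorm_eq_ofReal_abs,
      Real.enorm_eq_ofReal_abs]
  simp_rw [this]
  rw [lintegral_add_left (by fun_prop)]
  refine (add_le_add (G_L1 ht x) (G_L1 ht x')).trans (le_of_eq ?_)
  rw [← ENNReal.ofReal_add (by norm_num) (by norm_num)]; norm_num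

/-! ### d-dimensional bounds -/

lemma coord_le {d : ℕ} (x : EuclideanSpace ℝ (Fin d)) (i : Fin d) : |x i| ≤ ‖x‖ := by
  rw [← Real.norm_eq_abs]; exact PiLp.norm_apply_le x i

lemma Gd_sup {d : ℕ} {t : ℝ} (ht : 0 < t) (x x' y : EuclideanSpace ℝ (Fin d)) :
    |Gd d t x y - Gd d t x' y|
      ≤ (d * 20 ^ d * min 1 (‖x - x'‖ / Real.sqrt t)) * (1 / Real.sqrt t) ^ d := by
  unfold Gd
  refine (abs_prod_sub_le d _ _).trans ?_
  calc _ ≤ ∑ i : Fin d, ∏ k : Fin d, ((20 * (1 / Real.sqrt t)) *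
        (if k = i then min 1 (‖x - x'‖ / Real.sqrt t) else 1)) := by
        refine Finset.sum_le_sum fun i _ => Finset.prod_le_prod (fun k _ => ?_) (fun k _ => ?_)
        · split_ifs <;> positivity
        · split_ifs
          · exact G1_sup ht (coord_le (x - x') k) _
          · refine (add_le_add (G_sup ht _ _) (G_sup ht _ _)).trans (le_of_eq ?_)
            ring
    _ = _ := by
        simp_rw [prod_ite_bound]
        rw [Finset.sum_const, Finset.card_univ, Fintype.card_fin, nsmul_eq_mul, mul_pow]
        ring

lemma Gd_L1 {d : ℕ} {t : ℝ} (ht : 0 < t) (x x' : EuclideanSpace ℝ (Fin d)) :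
    ∫⁻ y in Q d, ‖Gd d t x y - Gd d t x' y‖ₑ
      ≤ ENNReal.ofReal (d * 20 ^ d * min 1 (‖x - x'‖ / Real.sqrt t)) := by
  have hc : ∀ u, Measurable (G t u) := fun u => (G_continuous ht u).measurable
  set m := min 1 (‖x - x'‖ / Real.sqrt t) with hm
  have hm0 : 0 ≤ m := by positivity
  have hmeas : ∀ i k : Fin d, Measurable (fun s : ℝ => ENNReal.ofReal
      (if k = i then |G t (x k) s - G t (x' k) s| else |G t (x k) s| + |G t (x' k) s|)) := by
    intro i k
    have := hc (x k)
    have := hc (x' k)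
    split_ifs
    · exact ENNReal.measurable_ofReal.comp (by simp_rw [← Real.norm_eq_abs]; fun_prop)
    · exact ENNReal.measurable_ofReal.comp (by simp_rw [← Real.norm_eq_abs]; fun_prop)
  calc ∫⁻ y in Q d, ‖Gd d t x y - Gd d t x' y‖ₑ
      ≤ ∫⁻ y in Q d, ∑ i : Fin d, ∏ k : Fin d, ENNReal.ofReal
          (if k = i then |G t (x k) (y k) - G t (x' k) (y k)|
            else |G t (x k) (y k)| + |G t (x' k) (y k)|) := by
        apply lintegral_mono
        intro y
        dsimp only
        rw [Real.enorm_eq_ofReal_abs]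
        refine (ENNReal.ofReal_le_ofReal (abs_prod_sub_le d _ _)).trans (le_of_eq ?_)
        have hn : ∀ i k : Fin d, 0 ≤ (if k = i then |G t (x k) (y k) - G t (x' k) (y k)|
          else |G t (x k) (y k)| + |G t (x' k) (y k)|) := by
          intro i k; split_ifs <;> positivity
        rw [ENNReal.ofReal_sum_of_nonneg (fun i _ => Finset.prod_nonneg fun k _ => hn i k)]
        exact Finset.sum_congr rfl fun i _ => ENNReal.ofReal_prod_of_nonneg fun k _ => hn i k
    _ = ∑ i : Fin d, ∏ k : Fin d, ∫⁻ s in Set.Icc (0:ℝ) 1, ENNReal.ofReal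
          (if k = i then |G t (x k) s - G t (x' k) s| else |G t (x k) s| + |G t (x' k) s|) := by
        rw [lintegral_finsetSum]
        · exact Finset.sum_congr rfl fun i _ => lint_Q_prod d _ (hmeas i)
        · intro i _
          exact Finset.measurable_prod _ fun k _ => (hmeas i k).comp (by fun_prop)
    _ ≤ ∑ i : Fin d, ∏ k : Fin d, ENNReal.ofReal (20 * (if k = i then m else 1)) := by
        refine Finset.sum_le_sum fun i _ => Finset.prod_le_prod' fun k _ => ?_
        split_ifs
        · exact G1_L1 ht (coord_le (x - x') k)
        · rw [mul_one]; exact G1_L1_sum ht _ _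
    _ = _ := by
        have : ∀ i : Fin d, ∏ k : Fin d, ENNReal.ofReal (20 * (if k = i then m else 1))
            = ENNReal.ofReal (20 ^ d * m) := by
          intro i
          rw [← ENNReal.ofReal_prod_of_nonneg, prod_ite_bound]
          intro k _
          split_ifs <;> positivity
        simp_rw [this]
        rw [Finset.sum_const, Finset.card_univ, Fintype.card_fin, nsmul_eq_mul, mul_assoc,
          ENNReal.ofReal_mul (by positivity : (0:ℝ) ≤ d), ENNReal.ofReal_natCast]

/-! ### The Riesz kernel -/

lemma lint_rpow {a c : ℝ} (ha : -1 < a) (hc : 0 < c) :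
    ∫⁻ s in Set.Ioc 0 c, ENNReal.ofReal (s ^ a) = ENNReal.ofReal (c ^ (a + 1) / (a + 1)) := by
  have h1 : IntervalIntegrable (fun s : ℝ => s ^ a) volume 0 c :=
    intervalIntegral.intervalIntegrable_rpow' ha
  rw [← ofReal_integral_eq_lintegral_ofReal]
  · rw [← intervalIntegral.integral_of_le hc.le, integral_rpow (Or.inl ha),
      Real.zero_rpow (by linarith), sub_zero]
  · exact (intervalIntegrable_iff_integrableOn_Ioc_of_le hc.le).mp h1
  · exact (ae_restrict_iff' measurableSet_Ioc).mpr
      (Filter.Eventually.of_forall fun s hs => Real.rpow_nonneg hs.1.le _)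

lemma lint_rpow_Ioi {a c : ℝ} (ha : a < -1) (hc : 0 < c) :
    ∫⁻ s in Set.Ioi c, ENNReal.ofReal (s ^ a) = ENNReal.ofReal (-c ^ (a + 1) / (a + 1)) := by
  rw [← ofReal_integral_eq_lintegral_ofReal]
  · rw [integral_Ioi_rpow_of_lt ha hc]
  · exact integrableOn_Ioi_rpow_of_lt ha hc
  · exact (ae_restrict_iff' measurableSet_Ioi).mpr
      (Filter.Eventually.of_forall fun s hs => Real.rpow_nonneg (hc.trans hs).le _)

/-- Truncated one-dimensional kernel. -/
noncomputable def gk (r β : ℝ) (s : ℝ) : ENNReal :=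
  Set.indicator (Set.Ioo (-r) r) (fun s => ‖s‖ₑ ^ (-β)) s

lemma gk_measurable (r β : ℝ) : Measurable (gk r β) := by
  unfold gk
  exact Measurable.indicator (by fun_prop) measurableSet_Ioo

lemma gk_lint {r β : ℝ} (hr : 0 < r) (hβ : β < 1) :
    ∫⁻ s, gk r β s ≤ ENNReal.ofReal (2 / (1 - β) * r ^ (1 - β)) := by
  set k : ℝ → ENNReal := Set.indicator (Set.Icc 0 r) (fun s => ‖s‖ₑ ^ (-β)) with hk
  have hkm : Measurable k := Measurable.indicator (by fun_prop) measurableSet_Icc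
  have h1 : ∀ s, gk r β s ≤ k s + k (-s) := by
    intro s
    unfold gk
    by_cases hs : s ∈ Set.Ioo (-r) r
    · rw [Set.indicator_of_mem hs]
      rcases le_total 0 s with h | h
      · refine le_trans (le_of_eq ?_) le_self_add
        rw [hk, Set.indicator_of_mem (show s ∈ Set.Icc 0 r from ⟨h, hs.2.le⟩)]
      · refine le_trans (le_of_eq ?_) le_add_self
        rw [hk, Set.indicator_of_mem (show -s ∈ Set.Icc 0 r from ⟨by linarith, by linarith [hs.1]⟩),
          enorm_neg]
    · rw [Set.indicator_of_notMem hs]; exact zero_le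
  have h2 : ∫⁻ s, k s = ENNReal.ofReal (r ^ (1 - β) / (1 - β)) := by
    rw [hk, lintegral_indicator measurableSet_Icc, setLIntegral_congr Ioc_ae_eq_Icc.symm]
    have := lint_rpow (a := -β) (c := r) (by linarith) hr
    rw [show -β + 1 = 1 - β by ring] at this
    rw [← this]
    refine setLIntegral_congr_fun measurableSet_Ioc fun s hs => ?_
    rw [Real.enorm_of_nonneg hs.1.le, ENNReal.ofReal_rpow_of_pos hs.1]
  calc ∫⁻ s, gk r β s ≤ ∫⁻ s, (k s + k (-s)) := lintegral_mono h1
    _ = ENNReal.ofReal (r ^ (1 - β) / (1 - β)) + ENNReal.ofReal (r ^ (1 - β) / (1 - β)) := by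
      rw [lintegral_add_left hkm, lintegral_neg_eq_self k, h2]
    _ = _ := by
      have : 0 < 1 - β := by linarith
      rw [← ENNReal.ofReal_add (by positivity) (by positivity)]
      congr 1; ring

lemma kernel_pointwise {d : ℕ} (hd : 1 ≤ d) {α r : ℝ} (hα : 0 < α) (hr : 0 < r)
    (w : EuclideanSpace ℝ (Fin d)) :
    ENNReal.ofReal (‖w‖ ^ (-α)) ≤ ∏ i, gk r (α / d) (w i) + ENNReal.ofReal (r ^ (-α)) := by
  have hd0 : (0:ℝ) < d := by exact_mod_cast hd
  by_cases hw : ∀ i, w i ∈ Set.Ioo (-r) r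
  · refine le_trans ?_ le_self_add
    have h1 : ENNReal.ofReal (‖w‖ ^ (-α)) ≤ ‖w‖ₑ ^ (-α) := by
      rcases (norm_nonneg w).eq_or_lt with h | h
      · rw [← h, Real.zero_rpow (by linarith)]; simp
      · rw [← ENNReal.ofReal_rpow_of_pos h, ofReal_norm]
    have h2 : ‖w‖ₑ ^ (-α) = ∏ _i : Fin d, ‖w‖ₑ ^ (-(α / d)) := by
      rw [Finset.prod_const, Finset.card_univ, Fintype.card_fin, ← ENNReal.rpow_natCast,
        ← ENNReal.rpow_mul]
      congr 1
      field_simp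
    rw [h2] at h1
    refine h1.trans (Finset.prod_le_prod' fun i _ => ?_)
    unfold gk
    rw [Set.indicator_of_mem (hw i), ENNReal.rpow_neg, ENNReal.rpow_neg]
    apply ENNReal.inv_le_inv.mpr
    apply ENNReal.rpow_le_rpow _ (by positivity)
    rw [← ofReal_norm, ← ofReal_norm]
    exact ENNReal.ofReal_le_ofReal (PiLp.norm_apply_le w i)
  · refine le_trans ?_ le_add_self
    push Not at hw
    obtain ⟨i, hi⟩ := hw
    apply ENNReal.ofReal_le_ofReal
    apply Real.rpow_le_rpow_of_nonpos hr _ (by linarith)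
    refine le_trans ?_ (coord_le w i)
    by_contra hcon
    push Not at hcon
    exact hi (abs_lt.mp hcon)

lemma kernel_bound {d : ℕ} (hd : 1 ≤ d) {α r : ℝ} (hα : 0 < α) (hαd : α < d) (hr : 0 < r)
    (f : EuclideanSpace ℝ (Fin d) → ℝ) {M : ℝ} (hM0 : 0 ≤ M) (hM : ∀ z, |f z| ≤ M) 
    (y : EuclideanSpace ℝ (Fin d)) :
    ∫⁻ z in Q d, ENNReal.ofReal (‖y - z‖ ^ (-α)) * ‖f z‖ₑ ≤
      ENNReal.ofReal ((2 / (1 - α / d)) ^ d * r ^ (d - α) * M)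
        + ENNReal.ofReal (r ^ (-α)) * ∫⁻ z in Q d, ‖f z‖ₑ := by
  have hd0 : (0:ℝ) < d := by exact_mod_cast hd
  have hβ : α / d < 1 := by rw [div_lt_one hd0]; exact hαd
  have hgm := gk_measurable r (α / d)
  have hI : ∫⁻ z : EuclideanSpace ℝ (Fin d), ∏ i, gk r (α / d) ((y - z) i)
      ≤ ENNReal.ofReal ((2 / (1 - α / d)) ^ d * r ^ (d - α)) := by
    rw [lintegral_sub_left_eq_self (fun w : EuclideanSpace ℝ (Fin d) => ∏ i, gk r (α / d) (w i)) y,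
      lint_euc_prod d _ (fun _ => hgm), Finset.prod_const, Finset.card_univ, Fintype.card_fin]
    have h1 : 0 < 1 - α / d := by linarith
    calc _ ≤ (ENNReal.ofReal (2 / (1 - α / d) * r ^ (1 - α / d))) ^ d :=
          pow_le_pow_left' (gk_lint hr hβ) d
      _ = _ := by
        rw [← ENNReal.ofReal_pow (by positivity), mul_pow, ← Real.rpow_natCast (r ^ _),
          ← Real.rpow_mul hr.le]
        congr 3
        field_simp
  calc ∫⁻ z in Q d, ENNReal.ofReal (‖y - z‖ ^ (-α)) * ‖f z‖ₑ
      ≤ ∫⁻ z in Q d, ((∏ i, gk r (α / d) ((y - z) i)) * ENNReal.ofReal M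
          + ENNReal.ofReal (r ^ (-α)) * ‖f z‖ₑ) := by
        apply lintegral_mono
        intro z
        dsimp only
        refine (mul_le_mul_left (kernel_pointwise hd hα hr (y - z)) _).trans ?_
        rw [add_mul]
        gcongr
        rw [Real.enorm_eq_ofReal_abs]
        exact ENNReal.ofReal_le_ofReal (hM z)
    _ = (∫⁻ z in Q d, (∏ i, gk r (α / d) ((y - z) i))) * ENNReal.ofReal M
          + ENNReal.ofReal (r ^ (-α)) * ∫⁻ z in Q d, ‖f z‖ₑ := by
        have hmm : Measurable (fun z : EuclideanSpace ℝ (Fin d) =>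
            ∏ i, gk r (α / d) ((y - z) i)) := by
          refine Finset.measurable_prod _ fun i _ => hgm.comp ?_
          fun_prop
        rw [lintegral_add_left (hmm.mul_const _), lintegral_mul_const _ hmm,
          lintegral_const_mul' _ _ ENNReal.ofReal_ne_top]
    _ ≤ _ := by
        have h1 : 0 < 1 - α / d := by linarith
        gcongr
        rw [ENNReal.ofReal_mul (by positivity)]
        gcongr
        exact (setLIntegral_le_lintegral _ _).trans hI

lemma norm_bound {d : ℕ} (hd : 1 ≤ d) {α r : ℝ} (hα : 0 < α) (hαd : α < d) (hr : 0 < r)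
    (f : EuclideanSpace ℝ (Fin d) → ℝ) {A : ℝ} (hA : 0 ≤ A) (hM : ∀ z, |f z| ≤ A * (1 / r) ^ d)
    (hL : ∫⁻ z in Q d, ‖f z‖ₑ ≤ ENNReal.ofReal A) :
    ‖normAlphaSq d α f‖ₑ ≤
      ENNReal.ofReal (((2 / (1 - α / d)) ^ d + 1) * (A ^ 2 * r ^ (-α))) := by
  have hd0 : (0:ℝ) < d := by exact_mod_cast hd
  have hβ : α / d < 1 := by rw [div_lt_one hd0]; exact hαd
  have h1 : 0 < 1 - α / d := by linarith
  set K := (2 / (1 - α / d)) ^ d with hK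
  have hK0 : 0 ≤ K := by positivity
  have hin : ∀ y, ∫⁻ z in Q d, ENNReal.ofReal (‖y - z‖ ^ (-α)) * ‖f z‖ₑ
      ≤ ENNReal.ofReal ((K + 1) * (A * r ^ (-α))) := by
    intro y
    refine (kernel_bound hd hα hαd hr f (by positivity) hM y).trans ?_
    refine (add_le_add_right (mul_le_mul_right hL _) _).trans ?_
    rw [← ENNReal.ofReal_mul (by positivity), ← ENNReal.ofReal_add (by positivity) (by positivity)]
    apply ENNReal.ofReal_le_ofReal
    apply le_of_eq
    have : r ^ ((d:ℝ) - α) = r ^ d * r ^ (-α) := by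
      rw [sub_eq_add_neg, Real.rpow_add hr, Real.rpow_natCast]
    rw [← hK, this, one_div, inv_pow]
    field_simp
  unfold normAlphaSq
  calc _ ≤ ∫⁻ y in Q d, ‖∫ z in Q d, |f y| * ‖y - z‖ ^ (-α) * |f z|‖ₑ :=
        enorm_integral_le_lintegral_enorm _
    _ ≤ ∫⁻ y in Q d, ‖f y‖ₑ * ENNReal.ofReal ((K + 1) * (A * r ^ (-α))) := by
        apply lintegral_mono
        intro y
        dsimp only
        refine (enorm_integral_le_lintegral_enorm _).trans ?_
        have : ∀ z, ‖|f y| * ‖y - z‖ ^ (-α) * |f z|‖ₑ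
            = ‖f y‖ₑ * (ENNReal.ofReal (‖y - z‖ ^ (-α)) * ‖f z‖ₑ) := by
          intro z
          rw [enorm_mul, enorm_mul, Real.enorm_abs, Real.enorm_abs,
            Real.enorm_of_nonneg (by positivity : 0 ≤ ‖y - z‖ ^ (-α)), mul_assoc]
        simp_rw [this]
        rw [lintegral_const_mul' _ _ enorm_ne_top]
        gcongr
        exact hin y
    _ ≤ ENNReal.ofReal A * ENNReal.ofReal ((K + 1) * (A * r ^ (-α))) := by
        rw [lintegral_mul_const' _ _ ENNReal.ofReal_ne_top]
        gcongr
    _ = _ := by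
        rw [← ENNReal.ofReal_mul hA]
        congr 1; ring

/-! ### Time integral -/

lemma time_bound {α h : ℝ} (hα : 0 < α) (hα2 : α < 2) (hh : 0 < h) :
    ∫⁻ t in Set.Ioi (0:ℝ), ENNReal.ofReal ((min 1 (h / Real.sqrt t)) ^ 2 * (Real.sqrt t) ^ (-α))
      ≤ ENNReal.ofReal ((1 / (1 - α / 2) + 1 / (α / 2)) * h ^ (2 - α)) := by
  have hh2 : 0 < h ^ 2 := by positivity
  have e1 : ∀ t : ℝ, 0 < t → (Real.sqrt t) ^ (-α) = t ^ (-(α / 2)) := by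
    intro t ht
    rw [Real.sqrt_eq_rpow, ← Real.rpow_mul ht.le]
    congr 1; ring
  have hp : ∀ c : ℝ, (h ^ 2) ^ c = h ^ (2 * c) := by
    intro c
    rw [Real.rpow_mul hh.le, Real.rpow_two]
  rw [← Set.Ioc_union_Ioi_eq_Ioi hh2.le]
  refine (lintegral_union_le _ _ _).trans ?_
  have hA : ∫⁻ t in Set.Ioc 0 (h ^ 2),
      ENNReal.ofReal ((min 1 (h / Real.sqrt t)) ^ 2 * (Real.sqrt t) ^ (-α))
      ≤ ENNReal.ofReal (1 / (1 - α / 2) * h ^ (2 - α)) := by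
    calc _ ≤ ∫⁻ t in Set.Ioc 0 (h ^ 2), ENNReal.ofReal (t ^ (-(α / 2))) := by
          refine setLIntegral_mono' measurableSet_Ioc fun t ht => ?_
          apply ENNReal.ofReal_le_ofReal
          rw [e1 t ht.1]
          have h0 : 0 ≤ min 1 (h / Real.sqrt t) := by positivity
          have h1 : (min 1 (h / Real.sqrt t)) ^ 2 ≤ 1 := pow_le_one₀ h0 (min_le_left _ _)
          exact mul_le_of_le_one_left (Real.rpow_nonneg ht.1.le _) h1
      _ = _ := by
          rw [lint_rpow (by linarith) hh2, hp]
          congr 1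
          rw [show 2 * (-(α / 2) + 1) = 2 - α by ring, show -(α / 2) + 1 = 1 - α / 2 by ring]
          ring
  have hB : ∫⁻ t in Set.Ioi (h ^ 2),
      ENNReal.ofReal ((min 1 (h / Real.sqrt t)) ^ 2 * (Real.sqrt t) ^ (-α))
      ≤ ENNReal.ofReal (1 / (α / 2) * h ^ (2 - α)) := by
    calc _ ≤ ∫⁻ t in Set.Ioi (h ^ 2), ENNReal.ofReal (h ^ 2) * ENNReal.ofReal (t ^ (-1 - α / 2)) := by
          refine setLIntegral_mono' measurableSet_Ioi fun t ht => ?_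
          have ht0 : 0 < t := hh2.trans ht
          rw [← ENNReal.ofReal_mul hh2.le]
          apply ENNReal.ofReal_le_ofReal
          rw [e1 t ht0]
          have h0 : 0 ≤ min 1 (h / Real.sqrt t) := by positivity
          have h1 : (min 1 (h / Real.sqrt t)) ^ 2 ≤ (h / Real.sqrt t) ^ 2 :=
            pow_le_pow_left₀ h0 (min_le_right _ _) 2
          rw [div_pow, Real.sq_sqrt ht0.le] at h1
          refine (mul_le_mul_of_nonneg_right h1 (Real.rpow_nonneg ht0.le _)).trans (le_of_eq ?_)
          rw [show -1 - α / 2 = -1 + -(α / 2) by ring, Real.rpow_add ht0, Real.rpow_neg_one]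
          ring
      _ = _ := by
          rw [lintegral_const_mul' _ _ ENNReal.ofReal_ne_top, lint_rpow_Ioi (by linarith) hh2, hp,
            ← ENNReal.ofReal_mul hh2.le]
          congr 1
          rw [show 2 * (-1 - α / 2 + 1) = -α by ring, show -1 - α / 2 + 1 = -(α / 2) by ring,
            show 2 - α = 2 + -α by ring, Real.rpow_add hh, Real.rpow_two, neg_div_neg_eq]
          ring
  refine (add_le_add hA hB).trans (le_of_eq ?_)
  have : 0 < 1 - α / 2 := by linarith
  rw [← ENNReal.ofReal_add (by positivity) (by positivity), ← add_mul]

/-- space increments of the Green function in the `‖·‖_{(α)}` norm. -/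
theorem stmt_4 (d : ℕ) (hd : 1 ≤ d) (α : ℝ) (hα : α ∈ Set.Ioo (0 : ℝ) (min 2 (d : ℝ))) :
    ∃ C : ℝ, 0 < C ∧ ∀ x ∈ Q d, ∀ x' ∈ Q d,
      (∫ t in Set.Ioi (0 : ℝ), normAlphaSq d α (fun y => Gd d t x y - Gd d t x' y))
        ≤ C * ‖x - x'‖ ^ (2 - α) := by
  obtain ⟨hα0, hαm⟩ := hα
  have hα2 : α < 2 := lt_of_lt_of_le hαm (min_le_left _ _)
  have hαd : α < d := lt_of_lt_of_le hαm (min_le_right _ _)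
  have hd0 : (0:ℝ) < d := by exact_mod_cast hd
  have hβ : α / d < 1 := by rw [div_lt_one hd0]; exact hαd
  have h1 : 0 < 1 - α / d := by linarith
  have h2 : 0 < 1 - α / 2 := by linarith
  set B : ℝ := ((2 / (1 - α / d)) ^ d + 1) * ((d:ℝ) * 20 ^ d) ^ 2 with hB
  have hB0 : 0 < B := by positivity
  refine ⟨B * (1 / (1 - α / 2) + 1 / (α / 2)), by positivity, ?_⟩
  intro x _ x' _
  rcases (norm_nonneg (x - x')).eq_or_lt with h0 | h0
  · have hx : x = x' := sub_eq_zero.mp (norm_eq_zero.mp h0.symm)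
    subst hx
    rw [← h0, Real.zero_rpow (by linarith)]
    simp [normAlphaSq]
  have key : ‖∫ t in Set.Ioi (0 : ℝ), normAlphaSq d α (fun y => Gd d t x y - Gd d t x' y)‖ₑ
      ≤ ENNReal.ofReal (B * (1 / (1 - α / 2) + 1 / (α / 2)) * ‖x - x'‖ ^ (2 - α)) := by
    refine (enorm_integral_le_lintegral_enorm _).trans ?_
    calc _ ≤ ∫⁻ t in Set.Ioi (0:ℝ), ENNReal.ofReal B *
          ENNReal.ofReal ((min 1 (‖x - x'‖ / Real.sqrt t)) ^ 2 * (Real.sqrt t) ^ (-α)) := by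
          refine setLIntegral_mono' measurableSet_Ioi fun t ht => ?_
          have ht0 : 0 < t := ht
          have hs : 0 < Real.sqrt t := Real.sqrt_pos.mpr ht0
          refine (norm_bound hd hα0 hαd hs _ (by positivity) (fun z => Gd_sup ht0 x x' z)
            (Gd_L1 ht0 x x')).trans (le_of_eq ?_)
          rw [← ENNReal.ofReal_mul hB0.le]
          congr 1
          rw [hB]
          ring
      _ ≤ ENNReal.ofReal B * ENNReal.ofReal ((1 / (1 - α / 2) + 1 / (α / 2)) * ‖x - x'‖ ^ (2 - α)) := by
          rw [lintegral_const_mul' _ _ ENNReal.ofReal_ne_top]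
          gcongr
          exact time_bound hα0 hα2 h0
      _ = _ := by rw [← ENNReal.ofReal_mul hB0.le, mul_assoc B]
  rw [Real.enorm_eq_ofReal_abs, ENNReal.ofReal_le_ofReal_iff (by positivity)] at key
  exact (le_abs_self _).trans key
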